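/- Let 0 < a < 1, 0 < b < 1, P1 > 0, P2 > 0, ρ ∈ [0,1] and θ ∈ (0,1]. Set σ1² := (1−ρ)P1 + a(1−θ)P2 + 1 and σ2² := b(1−ρ)P1 + (1−θ)P2 + 1. Then (1/2)·log(1 + aθP2/σ1²) > (1/2)·log(1 + θP2/(bρP1 + σ2²)) if and only if P1·(ρ + ab − 1) > 1 − a; that is, R⁺2(1) > R⁻2(2) exactly when P1 > (1−a)/(ρ+ab−1) (with ρ+ab−1 > 0). -/

import Mathlib

/-- R⁺₂(1) > R⁻₂(2) if and only if P₁(ρ + ab − 1) > 1 − a. -/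
theorem stmt12 (a b P1 P2 ρ θ σ1sq σ2sq : ℝ)
    (ha : 0 < a) (ha1 : a < 1) (hb : 0 < b) (hb1 : b < 1)
    (hP1 : 0 < P1) (hP2 : 0 < P2)
    (hρ : ρ ∈ Set.Icc (0 : ℝ) 1) (hθ : θ ∈ Set.Ioc (0 : ℝ) 1)
    (hσ1 : σ1sq = (1 - ρ) * P1 + a * (1 - θ) * P2 + 1)
    (hσ2 : σ2sq = b * (1 - ρ) * P1 + (1 - θ) * P2 + 1) :
    (1 / 2) * Real.log (1 + a * θ * P2 / σ1sq) >
        (1 / 2) * Real.log (1 + θ * P2 / (b * ρ * P1 + σ2sq)) ↔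
      P1 * (ρ + a * b - 1) > 1 - a := by
  obtain ⟨hρ0, hρ1⟩ := hρ
  obtain ⟨hθ0, hθ1⟩ := hθ
  have h1 : 0 ≤ 1 - ρ := by linarith
  have h2 : 0 ≤ 1 - θ := by linarith
  have hs1 : 0 < σ1sq := by rw [hσ1]; positivity
  have hD : 0 < b * ρ * P1 + σ2sq := by rw [hσ2]; positivity
  have ht : 0 < θ * P2 := by positivity
  have e1 : 0 < 1 + a * θ * P2 / σ1sq := by positivity
  have e2 : 0 < 1 + θ * P2 / (b * ρ * P1 + σ2sq) := by positivity
  have key : a * θ * P2 * (b * ρ * P1 + σ2sq) - θ * P2 * σ1sq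
      = θ * P2 * (P1 * (ρ + a * b - 1) - (1 - a)) := by
    rw [hσ1, hσ2]; ring
  rw [gt_iff_lt, mul_lt_mul_iff_right₀ (by norm_num : (0:ℝ) < 1 / 2),
    Real.log_lt_log_iff e2 e1, add_lt_add_iff_left, div_lt_div_iff₀ hD hs1,
    ← sub_pos, key, mul_pos_iff_of_pos_left ht, sub_pos]
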